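/- arXiv:2201.10030 — 3 statements merged into one kernel-verified Lean document; each statement's English description precedes it below -/
import Mathlib

section
/- Let x ∈ S_n. There exists a 312-avoiding permutation y ∈ S_n such that x is 312-avoiding and sylvester-congruent to Pop(y) if and only if x is 312-avoiding, x_n = n, and x has no double descents. -/
/-- `w` is (the word of) a permutation of `{1, …, n}`. -/
def IsPermWord (n : ℕ) (w : List ℕ) : Prop := w.Perm (List.range' 1 n)

/-- `w` is 312-avoiding: there are no positions `i < j < k` with `w_j < w_k < w_i`. -/
def Avoids312 (w : List ℕ) : Prop :=
  ¬ ∃ i j k : ℕ, i < j ∧ j < k ∧ k < w.length ∧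
      w.getD j 0 < w.getD k 0 ∧ w.getD k 0 < w.getD i 0

/-- `w` is 231-avoiding: there are no positions `i < j < k` with `w_k < w_i < w_j`. -/
def Avoids231 (w : List ℕ) : Prop :=
  ¬ ∃ i j k : ℕ, i < j ∧ j < k ∧ k < w.length ∧
      w.getD k 0 < w.getD i 0 ∧ w.getD i 0 < w.getD j 0

/-- `w` has a double descent: three consecutive strictly decreasing entries. -/
def HasDoubleDescent (w : List ℕ) : Prop :=
  ∃ i : ℕ, i + 2 < w.length ∧
    w.getD (i + 1) 0 < w.getD i 0 ∧ w.getD (i + 2) 0 < w.getD (i + 1) 0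

/-- Length of the maximal strictly decreasing run at the start of a word. -/
def decRunLen : List ℕ → ℕ
  | [] => 0
  | [_] => 1
  | a :: b :: rest => if b < a then decRunLen (b :: rest) + 1 else 1

lemma one_le_decRunLen (a : ℕ) (t : List ℕ) : 1 ≤ decRunLen (a :: t) := by
  cases t <;> simp [decRunLen] <;> split <;> omega

/-- The pop-stack-sorting map on words: reverse every maximal descending run. -/
def popWord (w : List ℕ) : List ℕ :=
  match w with
  | [] => []
  | a :: t =>
      ((a :: t).take (decRunLen (a :: t))).reverse ++
        popWord ((a :: t).drop (decRunLen (a :: t)))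
termination_by w.length
decreasing_by
  have := one_le_decRunLen a t
  simp [List.length_drop]
  omega

/-- Two words are sylvester-adjacent if one is `X a c Y b Z` and the other is
`X c a Y b Z` for letters `a < b < c`. -/
def SylvAdj (u v : List ℕ) : Prop :=
  ∃ (X Y Z : List ℕ) (a b c : ℕ), a < b ∧ b < c ∧
    u = X ++ a :: c :: (Y ++ b :: Z) ∧ v = X ++ c :: a :: (Y ++ b :: Z)

/-- The sylvester congruence: the reflexive-symmetric-transitive closure of
sylvester-adjacency. -/
def SylvCongr : List ℕ → List ℕ → Prop := Relation.EqvGen SylvAdj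

/-- Structural form of `Avoids312`, by recursion on the word. -/
def Av312 : List ℕ → Prop
  | [] => True
  | c :: t => t.Pairwise (fun a b => ¬ (a < b ∧ b < c)) ∧ Av312 t

lemma av312_append (u v : List ℕ) : Av312 (u ++ v) ↔
    Av312 u ∧ Av312 v ∧ (∀ c ∈ u, v.Pairwise (fun a b => ¬ (a < b ∧ b < c))) ∧
      u.Pairwise (fun c a => ∀ b ∈ v, ¬ (a < b ∧ b < c)) := by
  induction u with
  | nil => simp [Av312]
  | cons c t ih =>
    simp only [List.cons_append, Av312, List.pairwise_append, ih, List.forall_mem_cons,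
      List.pairwise_cons]
    tauto

lemma avoids312_iff (w : List ℕ) : Avoids312 w ↔ Av312 w := by
  induction w with
  | nil => simp [Avoids312, Av312]
  | cons c t ih =>
    rw [Av312, ← ih, List.pairwise_iff_getElem]
    constructor
    · intro h
      refine ⟨fun i j hi hj hij hlt => h ⟨0, i + 1, j + 1, by omega, by omega, by simpa, ?_⟩, ?_⟩
      · simpa [hi, hj] using hlt
      · rintro ⟨i, j, k, hij, hjk, hk, hlt⟩
        exact h ⟨i + 1, j + 1, k + 1, by omega, by omega, by simpa, by simpa using hlt⟩
    · rintro ⟨h1, h2⟩ ⟨i, j, k, hij, hjk, hk, hlt⟩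
      obtain ⟨j, rfl⟩ : ∃ j', j = j' + 1 := ⟨j - 1, by omega⟩
      obtain ⟨k, rfl⟩ : ∃ k', k = k' + 1 := ⟨k - 1, by omega⟩
      simp only [List.length_cons, Nat.add_lt_add_iff_right] at hk hjk
      have hj : j < t.length := by omega
      cases i with
      | zero =>
        refine h1 j k hj hk hjk ?_
        simpa [hj, hk] using hlt
      | succ i => exact h2 ⟨i, j, k, by omega, hjk, hk, by simpa using hlt⟩

/-- The absence of double descents, by recursion on the word. -/
def NoDoubleDescent : List ℕ → Prop
  | a :: b :: c :: t => ¬ (b < a ∧ c < b) ∧ NoDoubleDescent (b :: c :: t)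
  | _ => True

lemma not_hasDoubleDescent_iff (w : List ℕ) : ¬ HasDoubleDescent w ↔ NoDoubleDescent w := by
  induction w with
  | nil => simp [HasDoubleDescent, NoDoubleDescent]
  | cons a t ih =>
    match t, ih with
    | [], _ => simp [HasDoubleDescent, NoDoubleDescent]
    | [b], _ => simp [HasDoubleDescent, NoDoubleDescent]
    | b :: c :: t, ih =>
      rw [NoDoubleDescent, ← ih]
      constructor
      · intro h
        refine ⟨fun hlt => h ⟨0, by simp, by simpa using hlt⟩, ?_⟩
        rintro ⟨i, hi, hlt⟩
        exact h ⟨i + 1, by simp at hi ⊢; omega, by simpa using hlt⟩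
      · rintro ⟨h1, h2⟩ ⟨i, hi, hlt⟩
        cases i with
        | zero => exact h1 (by simpa using hlt)
        | succ i => exact h2 ⟨i, by simp at hi ⊢; omega, by simpa using hlt⟩

lemma NoDoubleDescent.tail {a : ℕ} {t : List ℕ} (h : NoDoubleDescent (a :: t)) :
    NoDoubleDescent t := by
  match t, h with
  | [], _ => trivial
  | [_], _ => trivial
  | _ :: _ :: _, h => exact h.2

lemma NoDoubleDescent.right {u v : List ℕ} (h : NoDoubleDescent (u ++ v)) :
    NoDoubleDescent v := by
  induction u with
  | nil => exact h
  | cons a t ih => exact ih h.tail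

lemma NoDoubleDescent.left {u v : List ℕ} (h : NoDoubleDescent (u ++ v)) :
    NoDoubleDescent u := by
  induction u with
  | nil => trivial
  | cons a t ih =>
    match t, ih, h with
    | [], _, _ => trivial
    | [_], _, _ => trivial
    | _ :: _ :: _, ih, h => exact ⟨h.1, ih h.2⟩

/-- No double descent straddles a junction where the word increases. -/
lemma NoDoubleDescent.append {u v : List ℕ} (hu : NoDoubleDescent u) (hv : NoDoubleDescent v)
    (h : ∀ a ∈ u, ∀ b ∈ v.head?, a < b) : NoDoubleDescent (u ++ v) := by
  induction u with
  | nil => exact hv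
  | cons a t ih =>
    have ih := ih hu.tail (fun a ha => h a (List.mem_cons_of_mem _ ha))
    match t, v, ih, h, hu with
    | [], [], _, _, _ => trivial
    | [], [_], _, _, _ => trivial
    | [], b :: c :: v, ih, h, _ =>
      have := h a (by simp) b (by simp)
      exact ⟨by omega, ih⟩
    | [x], [], _, _, _ => trivial
    | [x], b :: v, ih, h, _ =>
      have := h x (by simp) b (by simp)
      exact ⟨by omega, ih⟩
    | _ :: _ :: _, _, ih, _, hu => exact ⟨hu.1, ih⟩

lemma decRunLen_le_length (w : List ℕ) : decRunLen w ≤ w.length := by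
  induction w with
  | nil => simp [decRunLen]
  | cons a t ih =>
    cases t with
    | nil => simp [decRunLen]
    | cons b t =>
      rw [decRunLen]
      split <;> simp at ih ⊢
      exact ih

lemma decRunLen_of_isChain {w : List ℕ} (h : w.IsChain (· > ·)) : decRunLen w = w.length := by
  induction w with
  | nil => rfl
  | cons a t ih =>
    cases t with
    | nil => rfl
    | cons b t =>
      rw [List.isChain_cons_cons] at h
      simp [decRunLen, h.1, ih h.2]

lemma decRunLen_append {a : ℕ} {u v : List ℕ} (h : ∀ x ∈ a :: u, ∀ b ∈ v.head?, x < b) :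
    decRunLen (a :: u ++ v) = decRunLen (a :: u) := by
  induction u generalizing a with
  | nil =>
    cases v with
    | nil => rfl
    | cons b v =>
      have := h a (by simp) b (by simp)
      simp [decRunLen]
      omega
  | cons x u ih =>
    have ih := ih (fun y hy => h y (List.mem_cons_of_mem _ hy))
    simp only [List.cons_append] at ih
    simp only [List.cons_append, decRunLen, ih]

lemma popWord_append (u v : List ℕ) (h : ∀ x ∈ u, ∀ b ∈ v.head?, x < b) :
    popWord (u ++ v) = popWord u ++ popWord v := by
  induction hk : u.length using Nat.strong_induction_on generalizing u with
  | _ k ih =>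
    cases u with
    | nil => simp [popWord]
    | cons a t =>
      have hle := decRunLen_le_length (a :: t)
      have hpos := one_le_decRunLen a t
      have hlen := decRunLen_append h
      rw [List.cons_append, popWord, popWord, ← List.cons_append, hlen,
        List.take_append_of_le_length hle, List.drop_append_of_le_length hle,
        ih _ (by rw [← hk, List.length_drop, List.length_cons]; omega) _
          (fun x hx => h x (List.mem_of_mem_drop hx)) rfl, List.append_assoc]

lemma popWord_of_isChain {w : List ℕ} (h : w.IsChain (· > ·)) : popWord w = w.reverse := by
  cases w with
  | nil => simp [popWord]
  | cons a t =>
    rw [popWord, decRunLen_of_isChain h]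
    simp [popWord]

lemma popWord_perm (w : List ℕ) : (popWord w).Perm w := by
  induction hk : w.length using Nat.strong_induction_on generalizing w with
  | _ k ih =>
    cases w with
    | nil => simp [popWord]
    | cons a t =>
      have hpos := one_le_decRunLen a t
      rw [popWord]
      have := ih _ (by rw [← hk, List.length_drop, List.length_cons]; omega)
        ((a :: t).drop (decRunLen (a :: t))) rfl
      have := (List.reverse_perm ((a :: t).take (decRunLen (a :: t)))).append this
      rwa [List.take_append_drop] at this

lemma SylvCongr.context {u v : List ℕ} (h : SylvCongr u v) (P S : List ℕ) :
    SylvCongr (P ++ u ++ S) (P ++ v ++ S) := by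
  induction h with
  | rel u v h =>
    obtain ⟨X, Y, Z, a, b, c, hab, hbc, rfl, rfl⟩ := h
    exact .rel _ _ ⟨P ++ X, Y, Z ++ S, a, b, c, hab, hbc, by simp, by simp⟩
  | refl u => exact .refl _
  | symm u v _ ih => exact .symm _ _ ih
  | trans u v w _ _ ih1 ih2 => exact .trans _ _ _ ih1 ih2

/-- Letters below `d` commute with letters above `d` as long as a `d` follows. -/
lemma sylvCongr_swap {A B : List ℕ} {d : ℕ} (hA : ∀ a ∈ A, a < d) (hB : ∀ b ∈ B, d < b) :
    SylvCongr (A ++ B ++ [d]) (B ++ A ++ [d]) := by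
  have single : ∀ a < d, ∀ B : List ℕ, (∀ b ∈ B, d < b) → ∀ S : List ℕ,
      SylvCongr (a :: B ++ S ++ [d]) (B ++ a :: S ++ [d]) := by
    intro a ha B hB S
    induction B with
    | nil => exact .refl _
    | cons b B ih =>
      refine .trans _ (b :: a :: B ++ S ++ [d]) _
        (.rel _ _ ⟨[], B ++ S, [], a, d, b, ha, hB b (by simp), by simp, by simp⟩) ?_
      simpa [SylvCongr] using (ih (fun x hx => hB x (by simp [hx]))).context [b] []
  induction A with
  | nil => simpa [SylvCongr] using Relation.EqvGen.refl _
  | cons a A ih =>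
    refine .trans _ (a :: B ++ A ++ [d]) _ ?_ (single a (hA a (by simp)) B hB A)
    simpa [SylvCongr] using (ih (fun x hx => hA x (by simp [hx]))).context [a] []

/-- The normal form of the sylvester class of the reversal of a word: the postorder
reading of the binary search tree obtained by inserting the letters in order. -/
def sylvNormRev : List ℕ → List ℕ
  | [] => []
  | r :: t => sylvNormRev (t.filter (· < r)) ++ sylvNormRev (t.filter (r < ·)) ++ [r]
termination_by w => w.length
decreasing_by
  · simpa using Nat.lt_succ_of_le (List.length_filter_le _ t.attach)
  · simpa using Nat.lt_succ_of_le (List.length_filter_le _ t.attach)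

lemma sylvNormRev_swap {a b c : ℕ} (hab : a < b) (hbc : b < c) (X Y Z : List ℕ) :
    sylvNormRev (X ++ b :: (Y ++ a :: c :: Z)) = sylvNormRev (X ++ b :: (Y ++ c :: a :: Z)) := by
  induction hk : X.length + Y.length + Z.length using Nat.strong_induction_on
    generalizing X Y Z with
  | _ k ih =>
    cases X with
    | nil =>
      simp [sylvNormRev, List.filter_append, hab, hbc, hab.not_gt, hbc.not_gt]
    | cons r X =>
      have key : ∀ p : ℕ → Bool, (p a → p c → p b) →
          sylvNormRev ((X ++ b :: (Y ++ a :: c :: Z)).filter p) =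
            sylvNormRev ((X ++ b :: (Y ++ c :: a :: Z)).filter p) := by
        intro p hp
        by_cases h : p a = true ∧ p c = true
        · have := ih _ ?_ (X.filter p) (Y.filter p) (Z.filter p) rfl
          · simpa [List.filter_append, List.filter_cons, h.1, h.2, hp h.1 h.2] using this
          · have h1 := List.length_filter_le p X
            have h2 := List.length_filter_le p Y
            have h3 := List.length_filter_le p Z
            simp only [List.length_cons] at hk
            omega
        · congr 1
          simp only [List.filter_append, List.filter_cons]
          split <;> split <;> simp_all
      simp only [List.cons_append, sylvNormRev]
      rw [key _ (by simp; omega), key _ (by simp; omega)]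

lemma SylvCongr.sylvNormRev_eq {u v : List ℕ} (h : SylvCongr u v) :
    sylvNormRev u.reverse = sylvNormRev v.reverse := by
  induction h with
  | rel u v h =>
    obtain ⟨X, Y, Z, a, b, c, hab, hbc, rfl, rfl⟩ := h
    simpa using (sylvNormRev_swap hab hbc Z.reverse Y.reverse X.reverse).symm
  | refl u => rfl
  | symm u v _ ih => exact ih.symm
  | trans u v w _ _ ih1 ih2 => exact ih1.trans ih2

lemma eq_filter_append_filter {W : List ℕ} {d : ℕ} (hd : d ∉ W)
    (h : W.Pairwise (fun c a => ¬ (a < d ∧ d < c))) :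
    W = W.filter (· < d) ++ W.filter (d < ·) := by
  induction W with
  | nil => rfl
  | cons c t ih =>
    rw [List.pairwise_cons] at h
    rw [List.mem_cons, not_or] at hd
    have ih := ih hd.2 h.2
    rcases lt_or_gt_of_ne hd.1 with hlt | hlt
    · have h0 : t.filter (· < d) = [] := by
        simp only [List.filter_eq_nil_iff, decide_eq_true_eq]
        exact fun a ha hlt' => h.1 a ha ⟨hlt', hlt⟩
      rw [h0, List.nil_append] at ih
      simp [hlt, hlt.not_gt, h0, ← ih]
    · simp only [List.filter_cons, hlt, hlt.not_gt, decide_true, decide_false, if_true,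
        List.cons_append]
      simpa using ih

/-- In a 312-avoiding word the letters before `d` that are smaller than `d` precede
those that are larger. -/
lemma Av312.exists_split {W S : List ℕ} {d : ℕ} (h : Av312 (W ++ d :: S)) (hd : d ∉ W) :
    ∃ A B : List ℕ, W = A ++ B ∧ (∀ a ∈ A, a < d) ∧ ∀ b ∈ B, d < b := by
  refine ⟨_, _, eq_filter_append_filter hd ?_, by simp, by simp⟩
  exact ((av312_append _ _).1 h).2.2.2.imp fun h => h d (by simp)

lemma Av312.sylvNormRev_reverse {w : List ℕ} (h : Av312 w) (hw : w.Nodup) :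
    sylvNormRev w.reverse = w := by
  induction hk : w.length using Nat.strong_induction_on generalizing w with
  | _ k ih =>
    rcases List.eq_nil_or_concat' w with rfl | ⟨W, r, rfl⟩
    · simp [sylvNormRev]
    · have hr : r ∉ W := by
        rw [List.nodup_append] at hw
        exact fun hr => hw.2.2 r hr r (by simp) rfl
      obtain ⟨A, B, rfl, hA, hB⟩ := h.exists_split hr
      have hA' := (av312_append _ _).1 ((av312_append _ _).1 h).1
      have hn := List.nodup_append.1 (List.nodup_append.1 hw).1
      have fA : A.reverse.filter (· < r) = A.reverse := by simpa using hA
      have fA' : A.reverse.filter (r < ·) = [] := by simpa using fun a ha => (hA a ha).le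
      have fB : B.reverse.filter (r < ·) = B.reverse := by simpa using hB
      have fB' : B.reverse.filter (· < r) = [] := by simpa using fun a ha => (hB a ha).le
      simp only [List.reverse_append, List.reverse_singleton, List.singleton_append, sylvNormRev,
        List.filter_append, fA, fA', fB, fB', List.nil_append, List.append_nil]
      simp only [List.length_append, List.length_singleton] at hk
      rw [ih _ (by omega) hA'.1 hn.1 rfl, ih _ (by omega) hA'.2.1 hn.2.1 rfl]

/-- A sylvester class contains at most one 312-avoiding word. -/
lemma SylvCongr.eq_of_av312 {u v : List ℕ} (h : SylvCongr u v) (hu : Av312 u) (hv : Av312 v)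
    (nu : u.Nodup) (nv : v.Nodup) : u = v := by
  rw [← hu.sylvNormRev_reverse nu, h.sylvNormRev_eq, hv.sylvNormRev_reverse nv]

/-- `PopRel y x`: the word `y` is 312-avoiding and `x` is the 312-avoiding word in the
sylvester class of `Pop(y)`, generated by peeling off the maximum of `y` and the letter
following it. -/
inductive PopRel : List ℕ → List ℕ → Prop
  | nil : PopRel [] []
  | snoc {A E : List ℕ} {n : ℕ} : PopRel A E → (∀ a ∈ A, a < n) → PopRel (A ++ [n]) (E ++ [n])
  | step {Z D C A E : List ℕ} {d n : ℕ} : PopRel (Z ++ d :: D) (C ++ [d]) → PopRel A E →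
      (∀ a ∈ Z, a < d) → (∀ a ∈ D, a < d) → (∀ a ∈ A, d < a) → (∀ a ∈ A, a < n) → d < n →
      PopRel (Z ++ A ++ n :: d :: D) (C ++ E ++ [d] ++ [n])

lemma PopRel.perm {y x : List ℕ} (h : PopRel y x) : x.Perm y := by
  induction h with
  | nil => rfl
  | snoc _ _ ih => exact ih.append_right _
  | @step Z D C A E d n _ _ _ _ _ _ _ ih1 ih2 =>
    rw [List.perm_iff_count] at *
    intro a
    have h1 := ih1 a
    have h2 := ih2 a
    simp only [List.count_append, List.count_cons, List.count_nil] at *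
    omega

lemma PopRel.mem_iff {y x : List ℕ} (h : PopRel y x) {a : ℕ} : a ∈ x ↔ a ∈ y :=
  h.perm.mem_iff

lemma PopRel.mem_of_concat {Z D C : List ℕ} {d : ℕ} (h : PopRel (Z ++ d :: D) (C ++ [d])) {a : ℕ} :
    a ∈ C ↔ a ∈ Z ∨ a ∈ D := by
  have := h.perm.count_eq a
  simp only [List.count_append, List.count_cons, List.count_nil] at this
  rw [← List.count_pos_iff, ← List.count_pos_iff, ← List.count_pos_iff]
  omega

lemma PopRel.exists_concat {y x : List ℕ} (h : PopRel y x) :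
    x = [] ∨ ∃ X m, x = X ++ [m] ∧ ∀ a ∈ X, a < m := by
  cases h with
  | nil => exact .inl rfl
  | snoc h hA => exact .inr ⟨_, _, rfl, fun a ha => hA a (h.mem_iff.1 ha)⟩
  | step h1 h2 hZ hD hA hA' hd =>
    refine .inr ⟨_, _, rfl, ?_⟩
    intro a ha
    simp only [List.mem_append, List.mem_singleton, h1.mem_of_concat, h2.mem_iff] at ha
    grind

lemma PopRel.noDoubleDescent {y x : List ℕ} (h : PopRel y x) : NoDoubleDescent x := by
  induction h with
  | nil => trivial
  | snoc h hA ih => exact ih.append trivial (by simpa [h.mem_iff] using hA)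
  | @step Z D C A E d n h1 h2 hZ hD hA hA' hd ih1 ih2 =>
    have hC : ∀ c ∈ C, c < d := fun c hc => (h1.mem_of_concat.1 hc).elim (hZ c) (hD c)
    refine NoDoubleDescent.append ?_ trivial ?_
    · rcases h2.exists_concat with rfl | ⟨X, m, rfl, hX⟩
      · simpa using ih1
      · have hXd : ∀ a ∈ X ++ [m], d < a := fun a ha => hA a (h2.mem_iff.1 ha)
        rw [List.append_assoc]
        refine ih1.left.append ?_ ?_
        · rw [List.append_assoc]
          exact ih2.left.append trivial (by simpa using hX)
        · intro c hc b hb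
          have := hXd b (by cases X <;> simp_all)
          have := hC c hc
          omega
    · intro a ha b hb
      simp only [List.head?_cons, Option.mem_some_iff] at hb
      simp only [List.mem_append, List.mem_singleton, h2.mem_iff] at ha
      grind

lemma PopRel.av312_left {y x : List ℕ} (h : PopRel y x) : Av312 y := by
  induction h with
  | nil => trivial
  | snoc h hA ih =>
    refine (av312_append _ _).2 ⟨ih, by simp [Av312], by simp, ?_⟩
    exact List.pairwise_of_forall_mem_list fun c hc a _ b hb => by
      have := hA c hc
      simp only [List.mem_singleton] at hb
      omega
  | @step Z D C A E d n h1 h2 hZ hD hA hA' hd ih1 ih2 =>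
    simp only [av312_append, Av312, List.pairwise_append, List.pairwise_cons, List.mem_append,
      List.mem_cons] at ih1 ⊢
    obtain ⟨ih3, ⟨ih4, ih5⟩, ih6, ih7⟩ := ih1
    refine ⟨⟨ih3, ih2, ?_, ?_⟩, ⟨⟨?_, ?_⟩, ih4, ih5⟩, ?_, ?_, ?_, ?_⟩
    · exact fun c hc => List.pairwise_of_forall_mem_list (by grind)
    · exact List.pairwise_of_forall_mem_list (by grind)
    · grind
    · exact ih4.imp_of_mem (by grind)
    · rintro c (hc | hc)
      · exact ⟨by grind, ih6 c hc⟩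
      · exact ⟨by grind, by grind, ih4.imp_of_mem (by grind)⟩
    · exact ih7.imp_of_mem (by grind)
    · exact List.pairwise_of_forall_mem_list (by grind)
    · grind

lemma PopRel.av312_right {y x : List ℕ} (h : PopRel y x) : Av312 x := by
  induction h with
  | nil => trivial
  | snoc h hA ih =>
    refine (av312_append _ _).2 ⟨ih, by simp [Av312], by simp, ?_⟩
    exact List.pairwise_of_forall_mem_list fun c hc a _ b hb => by
      have := hA c (h.mem_iff.1 hc)
      simp only [List.mem_singleton] at hb
      omega
  | @step Z D C A E d n h1 h2 hZ hD hA hA' hd ih1 ih2 =>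
    have hC : ∀ c ∈ C, c < d := fun c hc => (h1.mem_of_concat.1 hc).elim (hZ c) (hD c)
    have hE : ∀ c ∈ E, d < c ∧ c < n := fun c hc =>
      ⟨hA c (h2.mem_iff.1 hc), hA' c (h2.mem_iff.1 hc)⟩
    rw [List.append_assoc, av312_append, av312_append]
    rw [av312_append] at ih1
    refine ⟨⟨ih1.1, ih2, ?_, ?_⟩, by simp [Av312], by grind, ?_⟩
    · exact fun c hc => List.pairwise_of_forall_mem_list (by grind)
    · exact List.pairwise_of_forall_mem_list (by grind)
    · rw [List.pairwise_append]
      exact ⟨List.pairwise_of_forall_mem_list (by grind),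
        List.pairwise_of_forall_mem_list (by grind), by grind⟩

lemma Av312.pairwise_of_max {Z D : List ℕ} {d : ℕ} (h : Av312 (Z ++ d :: D))
    (hD : ∀ a ∈ D, a < d) (hn : D.Nodup) : (d :: D).IsChain (· > ·) := by
  rw [List.isChain_iff_pairwise, List.pairwise_cons]
  refine ⟨hD, ?_⟩
  have := ((av312_append _ _).1 h).2.1.1
  exact (this.and hn).imp_of_mem fun {a b} ha hb hab => by
    have := hD b hb
    have := hab.1
    have := hab.2
    omega

lemma PopRel.sylvCongr {y x : List ℕ} (h : PopRel y x) (hy : y.Nodup) :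
    SylvCongr x (popWord y) := by
  induction h with
  | nil => simpa [SylvCongr, popWord] using Relation.EqvGen.refl _
  | @snoc A E n h hA ih =>
    rw [popWord_append _ _ (by simpa using hA)]
    simpa [popWord, decRunLen] using (ih (List.nodup_append.1 hy).1).context [] [n]
  | @step Z D C A E d n h1 h2 hZ hD hA hA' hd ih1 ih2 =>
    have hC : ∀ c ∈ C, c < d := fun c hc => (h1.mem_of_concat.1 hc).elim (hZ c) (hD c)
    have hE : ∀ c ∈ E, d < c := fun c hc => hA c (h2.mem_iff.1 hc)
    have hZD : (Z ++ d :: D).Nodup := hy.sublist (by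
      rw [List.append_assoc]
      exact (List.Sublist.refl Z).append ((List.sublist_cons_self _ _).trans
        (List.sublist_append_right _ _)))
    have hAn : A.Nodup := hy.sublist (by
      exact (List.sublist_append_right Z A).trans (List.sublist_append_left _ _))
    have hdec := h1.av312_left.pairwise_of_max hD (List.nodup_append.1 hZD).2.1.of_cons
    have hdec' : (n :: d :: D).IsChain (· > ·) := List.isChain_cons_cons.2 ⟨hd, hdec⟩
    replace ih1 := ih1 hZD
    rw [popWord_append _ _ (by simpa using hZ), popWord_of_isChain hdec] at ih1
    rw [List.append_assoc Z A, popWord_append Z _ ?_, popWord_append A _ (by simpa using hA'),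
      popWord_of_isChain hdec']
    · have e1 := (sylvCongr_swap hC hE).context [] [n]
      have e2 := ih1.context E [n]
      have hU : ∀ a ∈ popWord Z ++ D.reverse, a < d := by
        simp only [List.mem_append, List.mem_reverse, (popWord_perm Z).mem_iff]
        grind
      have e3 := SylvCongr.context (.symm _ _ (sylvCongr_swap hU hE)) [] [n]
      have e4 := (ih2 hAn).context (popWord Z ++ D.reverse) [d, n]
      have hpA : ∀ a ∈ popWord A, d < a := fun a ha => hA a ((popWord_perm A).mem_iff.1 ha)
      have hD' : ∀ a ∈ D.reverse, a < d := by simpa using hD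
      have e5 := (sylvCongr_swap hD' hpA).context (popWord Z) [n]
      simp only [List.reverse_cons, List.append_assoc, List.nil_append, List.cons_append]
        at e1 e2 e3 e4 e5 ⊢
      exact e1.trans _ _ _ (e2.trans _ _ _ (e3.trans _ _ _ (e4.trans _ _ _ e5)))
    · intro a ha b hb
      have := hZ a ha
      cases A <;> simp only [List.nil_append, List.cons_append, List.head?_cons,
        Option.mem_some_iff] at hb <;> grind

lemma Av312.exists_popRel {y : List ℕ} (h : Av312 y) (hy : y.Nodup) : ∃ x, PopRel y x := by
  induction hk : y.length using Nat.strong_induction_on generalizing y with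
  | _ k ih =>
    rcases eq_or_ne y [] with rfl | hne
    · exact ⟨[], .nil⟩
    obtain ⟨n, hn, hmax⟩ := y.toFinset.exists_max_image id (by simpa using hne)
    simp only [List.mem_toFinset, id] at hn hmax
    obtain ⟨Y, S, rfl⟩ := List.append_of_mem hn
    have hlt : ∀ a, a ∈ Y ∨ a ∈ S → a < n := by
      intro a ha
      refine lt_of_le_of_ne (hmax a (by grind)) ?_
      rintro rfl
      simp only [List.nodup_append, List.nodup_cons] at hy
      grind
    cases S with
    | nil =>
      obtain ⟨E, hE⟩ := ih _ (by simp [← hk]) ((av312_append _ _).1 h).1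
        (List.nodup_append.1 hy).1 rfl
      exact ⟨_, .snoc hE (by grind)⟩
    | cons d D =>
      have hYd : Av312 (Y ++ d :: D) := by
        simp only [av312_append, Av312, List.pairwise_cons, List.mem_cons] at h ⊢
        obtain ⟨h1, ⟨-, h2⟩, h3, h4⟩ := h
        exact ⟨h1, h2, fun c hc => (h3 c hc).2, h4.imp fun h b hb => h b (.inr hb)⟩
      have hYd' : (Y ++ d :: D).Nodup := hy.sublist (by simp)
      have hdY : d ∉ Y := by grind
      obtain ⟨Z, A, rfl, hZ, hA⟩ := hYd.exists_split hdY
      have hD : ∀ a ∈ D, a < d := by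
        intro a ha
        have h1 := (List.pairwise_cons.1 ((av312_append _ _).1 h).2.1.1).1 a ha
        have h2 := hlt a (by simp [ha])
        have h3 : a ≠ d := by grind
        omega
      have hZd : Av312 (Z ++ d :: D) := by
        obtain ⟨h1, h2, h3, h4⟩ := (av312_append _ _).1 hYd
        exact (av312_append _ _).2 ⟨((av312_append _ _).1 h1).1, h2,
          fun c hc => h3 c (by simp [hc]), (List.pairwise_append.1 h4).1⟩
      obtain ⟨E, hE⟩ := ih A.length (by simp [← hk]; omega)
        ((av312_append _ _).1 ((av312_append _ _).1 hYd).1).2.1 (by grind) rfl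
      obtain ⟨X, hX⟩ := ih (Z ++ d :: D).length (by simp [← hk]; omega) hZd
        (hYd'.sublist (by simp)) rfl
      have hd : d ∈ X := hX.mem_iff.2 (by simp)
      rcases hX.exists_concat with rfl | ⟨C, m, rfl, hC⟩
      · simp at hd
      · have hm : m ∈ Z ++ d :: D := hX.mem_iff.1 (by simp)
        obtain rfl : m = d := by grind
        exact ⟨_, .step hX hE hZ hD hA
          (fun a ha => hlt a (by simp [ha])) (hlt m (by simp))⟩

lemma exists_popRel_of_noDoubleDescent {X : List ℕ} {n : ℕ} (h : Av312 (X ++ [n]))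
    (hn : (X ++ [n]).Nodup) (hX : ∀ a ∈ X, a < n) (hd : NoDoubleDescent (X ++ [n])) :
    ∃ y, PopRel y (X ++ [n]) := by
  induction hk : X.length using Nat.strong_induction_on generalizing X n with
  | _ k ih =>
    rcases List.eq_nil_or_concat' X with rfl | ⟨W, d, rfl⟩
    · exact ⟨_, .snoc .nil (by simp)⟩
    have hWd := ((av312_append _ _).1 h).1
    have hnWd := (List.nodup_append.1 hn).1
    have hdW : d ∉ W := by grind
    obtain ⟨C, E, rfl, hC, hE⟩ := hWd.exists_split hdW
    have hCE := (av312_append _ _).1 ((av312_append _ _).1 hWd).1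
    have hndd := hd.left
    rw [List.append_assoc] at hndd
    have hCd : Av312 (C ++ [d]) := by
      rw [av312_append]
      exact ⟨hCE.1, by simp [Av312], by simp,
        List.pairwise_of_forall_mem_list (by grind)⟩
    obtain ⟨y1, hy1⟩ := ih C.length (by simp [← hk]) hCd (by grind) hC
      (hndd.left.append trivial (by simpa using hC)) rfl
    obtain ⟨y2, hy2⟩ : ∃ y, PopRel y E := by
      rcases List.eq_nil_or_concat' E with rfl | ⟨F, e, rfl⟩
      · exact ⟨_, .nil⟩
      refine ih F.length (by simp [← hk]; omega) hCE.2.1 (by grind) ?_ hndd.right.left rfl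
      have heF : e ∉ F := by grind
      obtain ⟨G, H, rfl, hG, hH⟩ := hCE.2.1.exists_split heF
      rcases List.eq_nil_or_concat' H with rfl | ⟨H, f, rfl⟩
      · simpa using hG
      · have : NoDoubleDescent ((C ++ G ++ H) ++ [f, e, d]) := by simpa using hd.left
        have h1 := hH f (by simp)
        have h2 := hE e (by simp)
        exact absurd ⟨h1, h2⟩ this.right.1
    have hdy : d ∈ y1 := hy1.mem_iff.1 (by simp)
    obtain ⟨Z, D, rfl⟩ := List.append_of_mem hdy
    have hZD : ∀ a, a ∈ Z ∨ a ∈ D → a < d := fun a ha => hC a (hy1.mem_of_concat.2 ha)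
    have hA : ∀ a ∈ y2, a ∈ E := fun a => hy2.mem_iff.2
    exact ⟨_, .step hy1 hy2 (fun a ha => hZD a (.inl ha)) (fun a ha => hZD a (.inr ha))
      (fun a ha => hE a (hA a ha)) (fun a ha => hX a (by simp [hA a ha])) (hX d (by simp))⟩

lemma IsPermWord.nodup {n : ℕ} {w : List ℕ} (h : IsPermWord n w) : w.Nodup :=
  (List.Perm.nodup_iff h).2 List.nodup_range'

lemma IsPermWord.mem_iff {n : ℕ} {w : List ℕ} (h : IsPermWord n w) {a : ℕ} :
    a ∈ w ↔ 1 ≤ a ∧ a ≤ n := by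
  rw [List.Perm.mem_iff h, List.mem_range'_1]
  omega

lemma IsPermWord.getD_eq_iff {n : ℕ} (hn : 1 ≤ n) {x : List ℕ} (hx : IsPermWord n x) :
    x.getD (n - 1) 0 = n ↔ ∃ X, x = X ++ [n] ∧ ∀ a ∈ X, a < n := by
  have hlen : x.length = n := by simpa using List.Perm.length_eq hx
  rcases List.eq_nil_or_concat' x with rfl | ⟨X, m, rfl⟩
  · simp at hlen
    omega
  have hX : X.length = n - 1 := by simp at hlen; omega
  have hlast : (X ++ [m]).getD (n - 1) 0 = m := by simp [← hX]
  rw [hlast]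
  constructor
  · rintro rfl
    refine ⟨X, rfl, fun a ha => lt_of_le_of_ne (hx.mem_iff.1 (by simp [ha])).2 ?_⟩
    have := hx.nodup
    grind
  · rintro ⟨Y, hY, -⟩
    simpa using (List.append_inj' hY rfl).2

/-- **Theorem (Statement 3).** For `x ∈ S_n`: there is a 312-avoiding `y ∈ S_n` such
that `x` is 312-avoiding and sylvester-congruent to `Pop(y)` iff `x` is 312-avoiding,
ends with `n`, and has no double descents. -/
theorem pop_image_characterization (n : ℕ) (hn : 1 ≤ n) (x : List ℕ)
    (hx : IsPermWord n x) :
    (∃ y : List ℕ, IsPermWord n y ∧ Avoids312 y ∧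
        Avoids312 x ∧ SylvCongr x (popWord y)) ↔
      (Avoids312 x ∧ x.getD (n - 1) 0 = n ∧ ¬ HasDoubleDescent x) := by
  simp only [avoids312_iff, not_hasDoubleDescent_iff, hx.getD_eq_iff hn]
  constructor
  · rintro ⟨y, hy, hyav, hxav, hxy⟩
    obtain ⟨z, hz⟩ := hyav.exists_popRel hy.nodup
    have hzn : IsPermWord n z := hz.perm.trans hy
    obtain rfl : x = z := SylvCongr.eq_of_av312
      (hxy.trans _ _ _ (hz.sylvCongr hy.nodup).symm) hxav hz.av312_right hx.nodup hzn.nodup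
    refine ⟨hxav, ?_, hz.noDoubleDescent⟩
    have hmem : n ∈ x := hx.mem_iff.2 ⟨hn, le_rfl⟩
    rcases hz.exists_concat with rfl | ⟨X, m, rfl, hX⟩
    · simp at hmem
    · have hm := (hx.mem_iff (a := m)).1 (by simp)
      obtain rfl : m = n := by grind
      exact ⟨X, rfl, hX⟩
  · rintro ⟨hxav, ⟨X, rfl, hX⟩, hdd⟩
    obtain ⟨y, hy⟩ := exists_popRel_of_noDoubleDescent hxav hx.nodup hX hdd
    have hyn : IsPermWord n y := hy.perm.symm.trans hx
    exact ⟨y, hyn, hy.av312_left, hxav, hy.sylvCongr hyn.nodup⟩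
end

section
/- Every bracket vector b ∈ Vec_n can be written as a sum b^{(1)} + ⋯ + b^{(r)} of irreducible bracket vectors. Moreover, for any such decomposition and any t ≥ 0, b is t-Pop-sortable if and only if every component b^{(i)} is t-Pop-sortable. -/
open scoped Classical

/-- `b` is a bracket vector of size `n`: a tuple `(b_0, …, b_{2n-1})` with
`b_{2k+1} = k`, `⌊i/2⌋ ≤ b_i ≤ n-1`, and such that `b_i = k` forces `b_j ≤ k`
for all `i+1 ≤ j ≤ 2k+1`. -/
def IsBracketVec (n : ℕ) (b : List ℕ) : Prop :=
  b.length = 2 * n ∧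
    (∀ k : ℕ, k < n → b.getD (2 * k + 1) 0 = k) ∧
    (∀ i : ℕ, i < 2 * n → i / 2 ≤ b.getD i 0 ∧ b.getD i 0 ≤ n - 1) ∧
    (∀ i : ℕ, i < 2 * n → ∀ j : ℕ, i + 1 ≤ j → j ≤ 2 * b.getD i 0 + 1 →
      b.getD j 0 ≤ b.getD i 0)

/-- The minimum bracket vector `m_n`, with `(m_n)_i = ⌊i/2⌋`. -/
def minVec (n : ℕ) : List ℕ := (List.range (2 * n)).map (fun i => i / 2)

/-- The entries of the image of a bracket vector of size `n` under `Pop`: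
`η_i(b) = b_i` if `i = 2n-1` or `b_i ≤ b_{i+1}`, and otherwise `η_i(b)` is the
largest `x` with `⌊i/2⌋ ≤ x ≤ b_i - 1` and `b_j ≤ x` for all `i+1 ≤ j ≤ 2x+1`. -/
noncomputable def eta (n : ℕ) (b : List ℕ) (i : ℕ) : ℕ :=
  if i = 2 * n - 1 ∨ b.getD i 0 ≤ b.getD (i + 1) 0 then b.getD i 0
  else ((Finset.range (b.getD i 0)).filter
      (fun x => i / 2 ≤ x ∧ ∀ j ∈ Finset.Icc (i + 1) (2 * x + 1), b.getD j 0 ≤ x)).sup id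

/-- The `Pop` operator on bracket vectors of size `n`. -/
noncomputable def popVec (n : ℕ) (b : List ℕ) : List ℕ := (List.range (2 * n)).map (eta n b)

/-- A bracket vector of size `n` is `t`-Pop-sortable if `t` applications of `Pop`
yield the minimum vector `m_n`. -/
def PopSortable (n t : ℕ) (b : List ℕ) : Prop := (popVec n)^[t] b = minVec n

/-- A bracket vector of size `n` is irreducible if `b_0 = b_{2n-1}`. -/
def IsIrredVec (n : ℕ) (b : List ℕ) : Prop :=
  IsBracketVec n b ∧ b.getD 0 0 = b.getD (2 * n - 1) 0

/-- The sum of a list of bracket vectors: the vector of `b ∈ Vec_{n₁}` and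
`b' ∈ Vec_{n₂}` is `(b_0, …, b_{2n₁-1}, b'_0 + n₁, …, b'_{2n₂-1} + n₁) ∈ Vec_{n₁+n₂}`. -/
def sumVecs : List (List ℕ) → List ℕ
  | [] => []
  | v :: L => v ++ (sumVecs L).map (· + v.length / 2)

/-- `L` is a decomposition of `b` into (nonempty) irreducible bracket vectors. -/
def IsIrredDecomp (b : List ℕ) (L : List (List ℕ)) : Prop :=
  (∀ v ∈ L, 1 ≤ v.length / 2 ∧ IsIrredVec (v.length / 2) v) ∧ b = sumVecs L

/-- The hash of a bracket vector: delete the first two entries and subtract `1`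
from all remaining entries. -/
def hashVec (b : List ℕ) : List ℕ := (b.drop 2).map (· - 1)

/-- The part of the definition of a bracket vector that is needed to control `Pop`:
conditions (i) and (ii) only. -/
def IsWeakBracketVec (n : ℕ) (b : List ℕ) : Prop :=
  b.length = 2 * n ∧
    (∀ k : ℕ, k < n → b.getD (2 * k + 1) 0 = k) ∧
    (∀ i : ℕ, i < 2 * n → i / 2 ≤ b.getD i 0 ∧ b.getD i 0 ≤ n - 1)

theorem IsBracketVec.isWeakBracketVec {n : ℕ} {b : List ℕ} (hb : IsBracketVec n b) :
    IsWeakBracketVec n b :=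
  ⟨hb.1, hb.2.1, hb.2.2.1⟩

theorem getD_map_of_lt (f : ℕ → ℕ) {l : List ℕ} {i : ℕ} (hi : i < l.length) :
    (l.map f).getD i 0 = f (l.getD i 0) := by
  simp [hi]

theorem getD_map_range (f : ℕ → ℕ) {m i : ℕ} (hi : i < m) :
    ((List.range m).map f).getD i 0 = f i := by
  simp [hi]

theorem getD_append_map_add {m : ℕ} {v w : List ℕ} (hv : v.length = 2 * m) {i : ℕ}
    (hi : i < w.length) :
    (v ++ w.map (· + m)).getD (2 * m + i) 0 = w.getD i 0 + m := by
  rw [List.getD_append_right _ _ _ _ (by omega), hv, Nat.add_sub_cancel_left,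
    getD_map_of_lt _ hi]

theorem eta_eq_of_stays {n : ℕ} {b : List ℕ} {i : ℕ}
    (h : i = 2 * n - 1 ∨ b.getD i 0 ≤ b.getD (i + 1) 0) : eta n b i = b.getD i 0 :=
  if_pos h

/-- At a descent, `eta` really is the largest admissible value. -/
theorem IsWeakBracketVec.isGreatest_eta {n : ℕ} {b : List ℕ} (hb : IsWeakBracketVec n b)
    {i : ℕ} (hi : i < 2 * n) (h : ¬(i = 2 * n - 1 ∨ b.getD i 0 ≤ b.getD (i + 1) 0)) :
    IsGreatest {x | x < b.getD i 0 ∧ i / 2 ≤ x ∧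
      ∀ j, i + 1 ≤ j → j ≤ 2 * x + 1 → b.getD j 0 ≤ x} (eta n b i) := by
  obtain ⟨-, hodd, hbd⟩ := hb
  set S := (Finset.range (b.getD i 0)).filter
    (fun x => i / 2 ≤ x ∧ ∀ j ∈ Finset.Icc (i + 1) (2 * x + 1), b.getD j 0 ≤ x) with hS
  have heta : eta n b i = S.sup id := if_neg h
  have hmem : ∀ x, x ∈ S ↔ x < b.getD i 0 ∧ i / 2 ≤ x ∧
      ∀ j, i + 1 ≤ j → j ≤ 2 * x + 1 → b.getD j 0 ≤ x := by
    intro x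
    simp only [hS, Finset.mem_filter, Finset.mem_range, Finset.mem_Icc, and_imp]
  push Not at h
  have hne : S.Nonempty := by
    refine ⟨i / 2, (hmem _).2 ⟨?_, le_rfl, fun j hj hj' => ?_⟩⟩
    · have := (hbd (i + 1) (by omega)).1
      omega
    · obtain rfl : j = 2 * (i / 2) + 1 := by omega
      exact (hodd (i / 2) (by omega)).le
  rw [heta]
  obtain ⟨x, hx, hx'⟩ := Finset.exists_mem_eq_sup S hne id
  refine ⟨(hmem _).1 (by rw [hx']; exact hx), fun y hy => ?_⟩
  exact Finset.le_sup (f := id) ((hmem y).2 hy)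

theorem length_popVec (n : ℕ) (b : List ℕ) : (popVec n b).length = 2 * n := by
  simp [popVec]

theorem getD_popVec {n i : ℕ} (b : List ℕ) (hi : i < 2 * n) :
    (popVec n b).getD i 0 = eta n b i :=
  getD_map_range _ hi

theorem IsWeakBracketVec.popVec {n : ℕ} {b : List ℕ} (hb : IsWeakBracketVec n b) :
    IsWeakBracketVec n (popVec n b) := by
  refine ⟨length_popVec n b, fun k hk => ?_, fun i hi => ?_⟩
  · rw [getD_popVec b (by omega), eta_eq_of_stays, hb.2.1 k hk]
    by_cases h : 2 * k + 1 = 2 * n - 1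
    · exact Or.inl h
    · have := (hb.2.2 (2 * k + 1 + 1) (by omega)).1
      rw [hb.2.1 k hk]
      omega
  · rw [getD_popVec b hi]
    by_cases h : i = 2 * n - 1 ∨ b.getD i 0 ≤ b.getD (i + 1) 0
    · rw [eta_eq_of_stays h]
      exact hb.2.2 i hi
    · have hx := (hb.isGreatest_eta hi h).1
      have := (hb.2.2 i hi).2
      exact ⟨hx.2.1, by have := hx.1; omega⟩

theorem IsWeakBracketVec.append {m k : ℕ} {v w : List ℕ} (hv : IsWeakBracketVec m v)
    (hw : IsWeakBracketVec k w) : IsWeakBracketVec (m + k) (v ++ w.map (· + m)) := by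
  refine ⟨by simp [hv.1, hw.1]; omega, fun j hj => ?_, fun i hi => ?_⟩
  · by_cases h : j < m
    · rw [List.getD_append _ _ _ _ (by rw [hv.1]; omega), hv.2.1 j h]
    · rw [show 2 * j + 1 = 2 * m + (2 * (j - m) + 1) by omega,
        getD_append_map_add hv.1 (by rw [hw.1]; omega), hw.2.1 _ (by omega)]
      omega
  · by_cases h : i < 2 * m
    · rw [List.getD_append _ _ _ _ (by rw [hv.1]; omega)]
      have := hv.2.2 i h
      omega
    · obtain ⟨i, rfl⟩ := Nat.exists_eq_add_of_le (not_lt.1 h)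
      rw [getD_append_map_add hv.1 (by rw [hw.1]; omega)]
      have := hw.2.2 i (by omega)
      omega

theorem eta_append_left {m k : ℕ} {v w : List ℕ} (hv : IsWeakBracketVec m v)
    (hw : IsWeakBracketVec k w) {i : ℕ} (hi : i < 2 * m) :
    eta (m + k) (v ++ w.map (· + m)) i = eta m v i := by
  have hvw := hv.append hw
  have hget : ∀ j, j < 2 * m → (v ++ w.map (· + m)).getD j 0 = v.getD j 0 := fun j hj =>
    List.getD_append _ _ _ _ (by rw [hv.1]; exact hj)
  by_cases hlast : i = 2 * m - 1
  · rw [eta_eq_of_stays (Or.inl hlast), eta_eq_of_stays, hget i hi]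
    by_cases hk : k = 0
    · left; omega
    · right
      have := (hvw.2.2 (i + 1) (by omega)).1
      have := (hv.2.2 i hi).2
      rw [hget i hi]
      omega
  · by_cases h : v.getD i 0 ≤ v.getD (i + 1) 0
    · rw [eta_eq_of_stays (Or.inr h), eta_eq_of_stays, hget i hi]
      right
      rwa [hget i hi, hget (i + 1) (by omega)]
    · have h₁ := hv.isGreatest_eta hi (by omega)
      have h₂ := hvw.isGreatest_eta (i := i) (by omega)
        (by rw [hget i hi, hget (i + 1) (by omega)]; omega)
      refine h₂.unique (Eq.subst (motive := fun S => IsGreatest S _) ?_ h₁)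
      ext x
      have := (hv.2.2 i hi).2
      simp only [Set.mem_ofPred_eq, hget i hi]
      refine and_congr_right fun hx => and_congr_right fun _ => ?_
      refine forall_congr' fun j => forall_congr' fun _ => forall_congr' fun _ => ?_
      rw [hget j (by omega)]

theorem eta_append_right {m k : ℕ} {v w : List ℕ} (hv : IsWeakBracketVec m v)
    (hw : IsWeakBracketVec k w) {i : ℕ} (hi : i < 2 * k) :
    eta (m + k) (v ++ w.map (· + m)) (2 * m + i) = eta k w i + m := by
  have hvw := hv.append hw
  have hget : ∀ j, j < 2 * k →
      (v ++ w.map (· + m)).getD (2 * m + j) 0 = w.getD j 0 + m := fun j hj =>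
    getD_append_map_add hv.1 (by rw [hw.1]; exact hj)
  by_cases hlast : i = 2 * k - 1
  · rw [eta_eq_of_stays (Or.inl hlast), eta_eq_of_stays (Or.inl (by omega)), hget i hi]
  · have hsucc := hget (i + 1) (by omega)
    rw [← add_assoc] at hsucc
    by_cases h : w.getD i 0 ≤ w.getD (i + 1) 0
    · rw [eta_eq_of_stays (Or.inr h), eta_eq_of_stays (Or.inr _), hget i hi]
      rw [hget i hi, hsucc]
      omega
    · have h₁ := hw.isGreatest_eta hi (by omega)
      have h₂ := hvw.isGreatest_eta (i := 2 * m + i) (by omega)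
        (by rw [hget i hi, hsucc]; omega)
      have hbd := (hw.2.2 i hi).2
      rw [hget i hi] at h₂
      refine h₂.unique ⟨⟨?_, ?_, fun j hj hj' => ?_⟩, fun y hy => ?_⟩
      · have := h₁.1.1
        omega
      · have := h₁.1.2.1
        omega
      · obtain ⟨j, rfl⟩ := Nat.exists_eq_add_of_le (show 2 * m ≤ j by omega)
        have hlt := h₁.1.1
        rw [hget j (by omega)]
        exact Nat.add_le_add_right (h₁.1.2.2 j (by omega) (by omega)) m
      · obtain ⟨hy₁, hy₂, hy₃⟩ := hy
        have : y - m ≤ eta k w i := by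
          refine h₁.2 ⟨by omega, by omega, fun j hj hj' => ?_⟩
          have := hy₃ (2 * m + j) (by omega) (by omega)
          rw [hget j (by omega)] at this
          omega
        omega

theorem map_range_two_mul_add (f : ℕ → ℕ) (m k : ℕ) :
    (List.range (2 * (m + k))).map f =
      (List.range (2 * m)).map f ++ (List.range (2 * k)).map (fun i => f (2 * m + i)) := by
  rw [mul_add, List.range_add, List.map_append, List.map_map]
  rfl

theorem popVec_append {m k : ℕ} {v w : List ℕ} (hv : IsWeakBracketVec m v)
    (hw : IsWeakBracketVec k w) :
    popVec (m + k) (v ++ w.map (· + m)) = popVec m v ++ (popVec k w).map (· + m) := by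
  rw [popVec, map_range_two_mul_add, popVec, popVec, List.map_map]
  congr 1
  · exact List.map_congr_left fun i hi => eta_append_left hv hw (List.mem_range.1 hi)
  · exact List.map_congr_left fun i hi => eta_append_right hv hw (List.mem_range.1 hi)

theorem IsWeakBracketVec.iterate_popVec {n : ℕ} {b : List ℕ} (hb : IsWeakBracketVec n b)
    (t : ℕ) : IsWeakBracketVec n ((_root_.popVec n)^[t] b) := by
  induction t with
  | zero => exact hb
  | succ t ih =>
    rw [Function.iterate_succ_apply']
    exact ih.popVec

theorem iterate_popVec_append {m k : ℕ} {v w : List ℕ} (hv : IsWeakBracketVec m v)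
    (hw : IsWeakBracketVec k w) (t : ℕ) :
    (popVec (m + k))^[t] (v ++ w.map (· + m)) =
      (popVec m)^[t] v ++ ((popVec k)^[t] w).map (· + m) := by
  induction t with
  | zero => rfl
  | succ t ih =>
    simp only [Function.iterate_succ_apply', ih]
    exact popVec_append (hv.iterate_popVec t) (hw.iterate_popVec t)

theorem minVec_add (m k : ℕ) :
    minVec (m + k) = minVec m ++ (minVec k).map (· + m) := by
  rw [minVec, map_range_two_mul_add, minVec, minVec, List.map_map]
  congr 1
  refine List.map_congr_left fun i _ => ?_
  simp only [Function.comp]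
  omega

theorem popSortable_append {m k : ℕ} {v w : List ℕ} (hv : IsWeakBracketVec m v)
    (hw : IsWeakBracketVec k w) (t : ℕ) :
    PopSortable (m + k) t (v ++ w.map (· + m)) ↔ PopSortable m t v ∧ PopSortable k t w := by
  have hlen : ((popVec m)^[t] v).length = (minVec m).length := by
    rw [(hv.iterate_popVec t).1, minVec, List.length_map, List.length_range]
  rw [PopSortable, iterate_popVec_append hv hw, minVec_add]
  refine ⟨fun h => ?_, fun ⟨h₁, h₂⟩ => congrArg₂ _ h₁ (congrArg _ h₂)⟩
  obtain ⟨h₁, h₂⟩ := List.append_inj h hlen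
  exact ⟨h₁, List.map_injective_iff.2 (add_left_injective m) h₂⟩

theorem sumVecs_spec (L : List (List ℕ))
    (hL : ∀ v ∈ L, IsWeakBracketVec (v.length / 2) v) :
    IsWeakBracketVec (L.map fun v => v.length / 2).sum (sumVecs L) ∧
      ∀ t, PopSortable (L.map fun v => v.length / 2).sum t (sumVecs L) ↔
        ∀ v ∈ L, PopSortable (v.length / 2) t v := by
  induction L with
  | nil =>
    refine ⟨⟨rfl, by simp, by simp⟩, fun t => ?_⟩
    have : (popVec 0)^[t] [] = minVec 0 := Function.iterate_fixed rfl t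
    simpa [PopSortable, sumVecs] using this
  | cons v L ih =>
    obtain ⟨hw, hsort⟩ := ih fun u hu => hL u (List.mem_cons_of_mem _ hu)
    have hv := hL v List.mem_cons_self
    refine ⟨hv.append hw, fun t => ?_⟩
    rw [List.forall_mem_cons, ← hsort t]
    exact popSortable_append hv hw t

/-- The block of a bracket vector below its first entry is an irreducible bracket vector. -/
theorem IsBracketVec.isIrredVec_take {n : ℕ} {b : List ℕ} (hb : IsBracketVec n b)
    (hn : 1 ≤ n) :
    IsIrredVec (b.getD 0 0 + 1) (b.take (2 * (b.getD 0 0 + 1))) := by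
  obtain ⟨hlen, hodd, hbd, hnest⟩ := hb
  have h0 := (hbd 0 (by omega)).2
  set m := b.getD 0 0 + 1 with hm
  have hget : ∀ j, j < 2 * m → (b.take (2 * m)).getD j 0 = b.getD j 0 := fun j hj => by
    simp [List.getD_eq_getElem?_getD, hj]
  have hle : ∀ j, j < 2 * m → b.getD j 0 ≤ m - 1 := fun j hj => by
    rcases Nat.eq_zero_or_pos j with rfl | hpos
    · omega
    · have := hnest 0 (by omega) j (by omega) (by omega)
      omega
  refine ⟨⟨by simp [hlen]; omega, fun k hk => ?_, fun i hi => ?_, fun i hi j hj hj' => ?_⟩, ?_⟩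
  · rw [hget _ (by omega), hodd k (by omega)]
  · rw [hget i hi]
    exact ⟨(hbd i (by omega)).1, hle i hi⟩
  · rw [hget i hi] at hj' ⊢
    have := hle i hi
    rw [hget j (by omega)]
    exact hnest i (by omega) j hj hj'
  · rw [hget 0 (by omega), hget (2 * m - 1) (by omega),
      show 2 * m - 1 = 2 * (b.getD 0 0) + 1 by omega, hodd _ (by omega)]

/-- What remains of a bracket vector after removing an initial block is a shifted
bracket vector. -/
theorem IsBracketVec.drop {n : ℕ} {b : List ℕ} (hb : IsBracketVec n b) {m : ℕ} (hm : m ≤ n) :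
    IsBracketVec (n - m) ((b.drop (2 * m)).map (· - m)) := by
  obtain ⟨hlen, hodd, hbd, hnest⟩ := hb
  have hget : ∀ j, j < 2 * (n - m) →
      ((b.drop (2 * m)).map (· - m)).getD j 0 = b.getD (2 * m + j) 0 - m := fun j hj => by
    rw [getD_map_of_lt _ (by simp [hlen]; omega)]
    simp [List.getD_eq_getElem?_getD]
  refine ⟨by simp [hlen]; omega, fun k hk => ?_, fun i hi => ?_, fun i hi j hj hj' => ?_⟩
  · rw [hget _ (by omega), show 2 * m + (2 * k + 1) = 2 * (m + k) + 1 by omega,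
      hodd _ (by omega)]
    omega
  · rw [hget i hi]
    have := hbd (2 * m + i) (by omega)
    omega
  · have := hbd (2 * m + i) (by omega)
    rw [hget i hi] at hj' ⊢
    rw [hget j (by omega)]
    exact Nat.sub_le_sub_right (hnest (2 * m + i) (by omega) _ (by omega) (by omega)) m

theorem IsBracketVec.take_append_drop {n : ℕ} {b : List ℕ} (hb : IsBracketVec n b) (m : ℕ) :
    b.take (2 * m) ++ ((b.drop (2 * m)).map (· - m)).map (· + m) = b := by
  conv_rhs => rw [← List.take_append_drop (2 * m) b]
  rw [List.map_map]
  congr 1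
  conv_rhs => rw [← List.map_id (b.drop (2 * m))]
  refine List.map_congr_left fun x hx => ?_
  obtain ⟨i, hi, rfl⟩ := List.mem_iff_getElem.1 hx
  rw [List.length_drop] at hi
  have hbd := (hb.2.2.1 (2 * m + i) (by have := hb.1; omega)).1
  rw [List.getD_eq_getElem _ _ (by omega)] at hbd
  simp only [List.getElem_drop, Function.comp, id]
  omega

theorem IsBracketVec.exists_isIrredDecomp (n : ℕ) (b : List ℕ) (hb : IsBracketVec n b) :
    ∃ L : List (List ℕ), IsIrredDecomp b L := by
  induction n using Nat.strong_induction_on generalizing b with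
  | _ n ih =>
  rcases Nat.eq_zero_or_pos n with rfl | hn
  · exact ⟨[], by simp, List.length_eq_zero_iff.1 hb.1⟩
  · have h0 := (hb.2.2.1 0 (by omega)).2
    have hirr := hb.isIrredVec_take hn
    set m := b.getD 0 0 + 1 with hm
    obtain ⟨L, hL, hsum⟩ := ih (n - m) (by omega) _ (hb.drop (m := m) (by omega))
    have hlen : (b.take (2 * m)).length / 2 = m := by rw [hirr.1.1]; omega
    refine ⟨b.take (2 * m) :: L, List.forall_mem_cons.2 ⟨?_, hL⟩, ?_⟩
    · rw [hlen]
      exact ⟨by omega, hirr⟩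
    · rw [sumVecs, hlen, ← hsum, hb.take_append_drop]

/-- **Theorem (Statement 4).** Every bracket vector can be decomposed into irreducible
bracket vectors; moreover, for any such decomposition and any `t ≥ 0`, the vector is
`t`-Pop-sortable iff every irreducible component is. -/
theorem bracketVec_irred_decomposition (n : ℕ) (hn : 1 ≤ n) (b : List ℕ)
    (hb : IsBracketVec n b) :
    (∃ L : List (List ℕ), IsIrredDecomp b L) ∧
      ∀ L : List (List ℕ), IsIrredDecomp b L → ∀ t : ℕ,
        (PopSortable n t b ↔ ∀ v ∈ L, PopSortable (v.length / 2) t v) := by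
  refine ⟨hb.exists_isIrredDecomp, fun L hL t => ?_⟩
  obtain ⟨hL, rfl⟩ := hL
  obtain ⟨hw, hsort⟩ := sumVecs_spec L fun v hv => (hL v hv).2.1.isWeakBracketVec
  obtain rfl : n = (L.map fun v => v.length / 2).sum := by
    have h₁ := hb.1
    have h₂ := hw.1
    omega
  exact hsort t
end

section
/- Fix t ≥ 1. Let h_t(n) be the number of t-Pop-sortable bracket vectors in Vec_n and g_t(n) the number of t-Pop-sortable irreducible bracket vectors in Vec_n. Then, with G_t(z) = Σ_{n≥1} g_t(n) z^n and H̃_t(z) = Σ_{n=1}^{t-1} h_t(n) z^n, the formal power series identity G_t(z) = z·((1 + H̃_t(z))·G_t(z) + 1) holds. Equivalently, g_t(1) = 1 and, for n ≥ 2, g_t(n) = g_t(n-1) + Σ_{k=1}^{min(t-1, n-2)} h_t(k)·g_t(n-1-k). -/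
open scoped Classical

/-- `a` is a bracket vector of size `n` restricted to its even positions, and extended by the
identity beyond `n`. -/
structure IsNestFun (n : ℕ) (a : ℕ → ℕ) : Prop where
  le : ∀ k, k ≤ a k
  lt : ∀ k, k < n → a k < n
  eq : ∀ k, n ≤ k → a k = k
  nest : ∀ k j, k < j → j ≤ a k → a j ≤ a k

/-- The admissible values of `Pop a` at `k`. -/
def PopAdmissible (a : ℕ → ℕ) (k x : ℕ) : Prop :=
  k ≤ x ∧ (x < a k ∨ x = k) ∧ ∀ j, k < j → j ≤ x → a j ≤ x

/-- The `Pop` operator on functions. -/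
noncomputable def popFun (a : ℕ → ℕ) (k : ℕ) : ℕ :=
  Nat.findGreatest (PopAdmissible a k) (a k + k)

lemma popFun_admissible (a : ℕ → ℕ) (k : ℕ) : PopAdmissible a k (popFun a k) :=
  Nat.findGreatest_spec (P := PopAdmissible a k) (m := k) (by omega)
    ⟨le_rfl, Or.inr rfl, fun j h1 h2 => by omega⟩

lemma PopAdmissible.le_popFun {a : ℕ → ℕ} {k x : ℕ} (h : PopAdmissible a k x) :
    x ≤ popFun a k :=
  Nat.le_findGreatest (by rcases h with ⟨_, h | h, _⟩ <;> omega) h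

lemma PopAdmissible.popFun_eq {a : ℕ → ℕ} {k x : ℕ} (h : PopAdmissible a k x)
    (h' : ∀ y, PopAdmissible a k y → y ≤ x) : popFun a k = x :=
  le_antisymm (h' _ (popFun_admissible a k)) h.le_popFun

lemma popFun_eq_self {a : ℕ → ℕ} {k : ℕ} (h : a k = k) : popFun a k = k := by
  obtain ⟨h1, h2, -⟩ := popFun_admissible a k
  omega

lemma popFun_lt_or_eq (a : ℕ → ℕ) (k : ℕ) : popFun a k < a k ∨ popFun a k = k :=
  (popFun_admissible a k).2.1

lemma popFun_lt {a : ℕ → ℕ} {n : ℕ} (h : ∀ k, k < n → a k < n) :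
    ∀ k, k < n → popFun a k < n := by
  intro k hk
  have := h k hk
  rcases popFun_lt_or_eq a k with h | h <;> omega

lemma IsNestFun.isNestFun_popFun {n : ℕ} {a : ℕ → ℕ} (h : IsNestFun n a) :
    IsNestFun n (popFun a) where
  le k := (popFun_admissible a k).1
  lt := popFun_lt h.lt
  eq k hk := popFun_eq_self (h.eq k hk)
  nest k j hkj hj := by
    have h1 := (popFun_admissible a k).2.2 j hkj hj
    have h2 := popFun_lt_or_eq a j
    omega

lemma popFun_id : popFun id = id := funext fun _ => popFun_eq_self rfl

lemma popFun_iterate_id (t : ℕ) : popFun^[t] id = id := Function.iterate_fixed popFun_id t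

lemma popFun_zero_of_forall_lt {a : ℕ → ℕ} (h : ∀ j, 0 < j → j < a 0 → a j < a 0) :
    popFun a 0 = a 0 - 1 := by
  refine PopAdmissible.popFun_eq ⟨by omega, by omega, fun j h1 h2 => ?_⟩ ?_
  · have := h j h1 (by omega)
    omega
  · rintro y ⟨h1, h2, -⟩
    omega

lemma popFun_forall_lt (a : ℕ → ℕ) (j : ℕ) (h1 : 0 < j) (h2 : j < popFun a 0) :
    popFun a j < popFun a 0 := by
  have h3 := (popFun_admissible a 0).2.2 j h1 h2.le
  rcases popFun_lt_or_eq a j with h | h <;> omega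

lemma popFun_iterate_succ_zero (a : ℕ → ℕ) (s : ℕ) :
    popFun^[s + 1] a 0 = popFun a 0 - s := by
  induction s with
  | zero => rfl
  | succ s ih =>
    rw [Function.iterate_succ_apply' popFun (s + 1) a, popFun_zero_of_forall_lt, ih, Nat.sub_sub]
    rw [Function.iterate_succ_apply']
    exact popFun_forall_lt _

/-- Put the value `m` in front of the function `h`, shifted by one. -/
def prependFun (m : ℕ) (h : ℕ → ℕ) : ℕ → ℕ
  | 0 => m
  | i + 1 => h i + 1

lemma popFun_prependFun_succ (m : ℕ) (h : ℕ → ℕ) (i : ℕ) :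
    popFun (prependFun m h) (i + 1) = popFun h i + 1 := by
  have key : ∀ x, PopAdmissible (prependFun m h) (i + 1) (x + 1) ↔ PopAdmissible h i x := by
    intro x
    simp only [PopAdmissible, prependFun]
    refine and_congr (by omega) (and_congr (by omega) ⟨fun H j h1 h2 => ?_, fun H j h1 h2 => ?_⟩)
    · have := H (j + 1) (by omega) (by omega)
      simpa [prependFun] using this
    · obtain ⟨j, rfl⟩ : ∃ l, j = l + 1 := ⟨j - 1, by omega⟩
      have := H j (by omega) (by omega)
      simpa [prependFun] using this
  refine ((key _).2 (popFun_admissible h i)).popFun_eq fun y hy => ?_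
  obtain ⟨y, rfl⟩ : ∃ l, y = l + 1 := ⟨y - 1, by have := hy.1; omega⟩
  have := ((key y).1 hy).le_popFun
  omega

lemma popFun_iterate_prependFun_succ (m : ℕ) (h : ℕ → ℕ) (s i : ℕ) :
    popFun^[s] (prependFun m h) (i + 1) = popFun^[s] h i + 1 := by
  induction s generalizing m h with
  | zero => rfl
  | succ s ih =>
    have : popFun (prependFun m h) = prependFun (popFun (prependFun m h) 0) (popFun h) := by
      funext j
      cases j with
      | zero => rfl
      | succ j => exact popFun_prependFun_succ m h j
    rw [Function.iterate_succ_apply, Function.iterate_succ_apply, this, ih]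

lemma popFun_iterate_prependFun_eq_id {t : ℕ} (ht : 1 ≤ t) (m : ℕ) (h : ℕ → ℕ) :
    popFun^[t] (prependFun m h) = id ↔
      popFun (prependFun m h) 0 < t ∧ popFun^[t] h = id := by
  obtain ⟨s, rfl⟩ : ∃ s, t = s + 1 := ⟨t - 1, by omega⟩
  constructor
  · intro H
    constructor
    · have := congrFun H 0
      rw [popFun_iterate_succ_zero, id] at this
      omega
    · funext i
      have := congrFun H (i + 1)
      rw [popFun_iterate_prependFun_succ, id] at this
      simpa using this
  · rintro ⟨h1, h2⟩
    funext i
    cases i with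
    | zero =>
      rw [popFun_iterate_succ_zero, id]
      omega
    | succ i =>
      rw [popFun_iterate_prependFun_succ, h2]
      rfl

/-- The sum of the functions `v` of size `k` and `c`. -/
def sumFun (k : ℕ) (v c : ℕ → ℕ) (i : ℕ) : ℕ := if i < k then v i else k + c (i - k)

lemma sumFun_of_lt {k i : ℕ} (v c : ℕ → ℕ) (h : i < k) : sumFun k v c i = v i := if_pos h

lemma sumFun_add (k : ℕ) (v c : ℕ → ℕ) (i : ℕ) : sumFun k v c (k + i) = k + c i := by
  simp [sumFun]

lemma popFun_sumFun {k : ℕ} {v : ℕ → ℕ} (hv : ∀ i, i < k → v i < k) (c : ℕ → ℕ) :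
    popFun (sumFun k v c) = sumFun k (popFun v) (popFun c) := by
  funext i
  by_cases hi : i < k
  · rw [sumFun_of_lt _ _ hi]
    have key : PopAdmissible (sumFun k v c) i = PopAdmissible v i := by
      funext x
      simp only [PopAdmissible, sumFun_of_lt _ _ hi, eq_iff_iff]
      refine and_congr_right fun _ => and_congr_right fun h2 => ?_
      have hx : x < k := by have := hv i hi; omega
      refine forall_congr' fun j => forall_congr' fun _ => forall_congr' fun h4 => ?_
      rw [sumFun_of_lt _ _ (by omega)]
    simp only [popFun, key, sumFun_of_lt _ _ hi]
  · obtain ⟨i, rfl⟩ : ∃ l, i = k + l := ⟨i - k, by omega⟩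
    rw [sumFun_add]
    have key : ∀ x, PopAdmissible (sumFun k v c) (k + i) (k + x) ↔ PopAdmissible c i x := by
      intro x
      simp only [PopAdmissible, sumFun_add]
      refine and_congr (by omega)
        (and_congr (by omega) ⟨fun H j h1 h2 => ?_, fun H j h1 h2 => ?_⟩)
      · have := H (k + j) (by omega) (by omega)
        rw [sumFun_add] at this
        omega
      · obtain ⟨j, rfl⟩ : ∃ l, j = k + l := ⟨j - k, by omega⟩
        have := H j (by omega) (by omega)
        rw [sumFun_add]
        omega
    refine ((key _).2 (popFun_admissible c i)).popFun_eq fun y hy => ?_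
    obtain ⟨y, rfl⟩ : ∃ l, y = k + l := ⟨y - k, by have := hy.1; omega⟩
    have := ((key y).1 hy).le_popFun
    omega

lemma popFun_iterate_sumFun {k : ℕ} {v : ℕ → ℕ} (hv : ∀ i, i < k → v i < k) (c : ℕ → ℕ)
    (s : ℕ) : popFun^[s] (sumFun k v c) = sumFun k (popFun^[s] v) (popFun^[s] c) := by
  induction s generalizing v c with
  | zero => rfl
  | succ s ih =>
    simp only [Function.iterate_succ_apply, popFun_sumFun hv, ih (popFun_lt hv)]

lemma IsNestFun.iterate {n : ℕ} {a : ℕ → ℕ} (h : IsNestFun n a) (s : ℕ) :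
    IsNestFun n (popFun^[s] a) := by
  induction s generalizing a with
  | zero => exact h
  | succ s ih => exact ih h.isNestFun_popFun

lemma IsNestFun.popFun_iterate_sumFun_eq_id {k : ℕ} {v : ℕ → ℕ} (hv : IsNestFun k v)
    (c : ℕ → ℕ) (s : ℕ) :
    popFun^[s] (sumFun k v c) = id ↔
      popFun^[s] v = id ∧ popFun^[s] c = id := by
  rw [popFun_iterate_sumFun hv.lt]
  constructor
  · intro H
    constructor
    · funext i
      by_cases hi : i < k
      · have := congrFun H i
        rwa [sumFun_of_lt _ _ hi] at this
      · exact (hv.iterate s).eq i (by omega)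
    · funext i
      have := congrFun H (k + i)
      rw [sumFun_add, id] at this
      simpa using this
  · rintro ⟨h1, h2⟩
    rw [h1, h2]
    funext i
    simp only [sumFun, id]
    split_ifs <;> omega

/-- The sortable functions of size `n`. -/
def sortableFuns (t n : ℕ) : Set (ℕ → ℕ) := {a | IsNestFun n a ∧ popFun^[t] a = id}

/-- The sortable irreducible functions of size `n`. -/
def irredSortableFuns (t n : ℕ) : Set (ℕ → ℕ) :=
  {a | (IsNestFun n a ∧ a 0 = n - 1) ∧ popFun^[t] a = id}

lemma finite_isNestFun (n : ℕ) : {a | IsNestFun n a}.Finite := by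
  refine (Set.finite_range
    fun (f : Fin n → Fin n) (i : ℕ) => if h : i < n then (f ⟨i, h⟩ : ℕ) else i).subset ?_
  intro a ha
  refine ⟨fun i => ⟨a i, ha.lt i i.2⟩, ?_⟩
  funext i
  by_cases h : i < n
  · simp [h]
  · simp [h, ha.eq i (by omega)]

lemma finite_irredSortableFuns (t n : ℕ) : (irredSortableFuns t n).Finite :=
  (finite_isNestFun n).subset fun _ h => h.1.1

/-- The irreducible function whose hash is the sum of `p.1`, of size `k`, and `p.2`. -/
def glueFun (n k : ℕ) (p : (ℕ → ℕ) × (ℕ → ℕ)) : ℕ → ℕ := prependFun n (sumFun k p.1 p.2)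

lemma IsNestFun.isNestFun_sumFun {k m : ℕ} {v c : ℕ → ℕ} (hv : IsNestFun k v)
    (hc : IsNestFun m c) :
    IsNestFun (k + m) (sumFun k v c) where
  le i := by
    unfold sumFun
    have := hv.le i
    have := hc.le (i - k)
    split_ifs <;> omega
  lt i hi := by
    unfold sumFun
    split_ifs with h
    · have := hv.lt i h
      omega
    · have := hc.lt (i - k) (by omega)
      omega
  eq i hi := by
    unfold sumFun
    have := hc.eq (i - k) (by omega)
    split_ifs <;> omega
  nest i j hij hj := by
    unfold sumFun at *
    split_ifs at * with h1 h2 h2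
    · exact hv.nest i j hij hj
    · omega
    · have := hv.lt i h2
      omega
    · have := hc.nest (i - k) (j - k) (by omega) (by omega)
      omega

lemma IsNestFun.isNestFun_prependFun {n : ℕ} {h : ℕ → ℕ} (hh : IsNestFun n h) :
    IsNestFun (n + 1) (prependFun n h) where
  le i := by
    cases i with
    | zero => exact Nat.zero_le _
    | succ i => exact Nat.succ_le_succ (hh.le i)
  lt i hi := by
    cases i with
    | zero => exact Nat.lt_succ_self n
    | succ i => exact Nat.succ_lt_succ (hh.lt i (by omega))
  eq i hi := by
    cases i with
    | zero => omega
    | succ i => exact congrArg (· + 1) (hh.eq i (by omega))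
  nest i j hij hj := by
    obtain ⟨j, rfl⟩ : ∃ l, j = l + 1 := ⟨j - 1, by omega⟩
    cases i with
    | zero => exact hh.lt j hj
    | succ i => exact Nat.succ_le_succ (hh.nest i j (by omega) (Nat.le_of_succ_le_succ hj))

lemma popFun_glueFun_zero {n k : ℕ} {v c : ℕ → ℕ} (hk : k < n) (hv : IsNestFun k v)
    (hc : c 0 = n - k - 1) : popFun (glueFun n k (v, c)) 0 = k := by
  refine PopAdmissible.popFun_eq ⟨Nat.zero_le _, Or.inl hk, fun j h1 h2 => ?_⟩ ?_
  · obtain ⟨j, rfl⟩ : ∃ l, j = l + 1 := ⟨j - 1, by omega⟩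
    simp only [glueFun, prependFun]
    rw [sumFun_of_lt _ _ (by omega)]
    exact hv.lt j (by omega)
  · rintro y ⟨-, h2, h3⟩
    by_contra! hy
    have := h3 (k + 1) (by omega) (by omega)
    have h4 := sumFun_add k v c 0
    simp only [glueFun, prependFun] at *
    rw [add_zero] at h4
    omega

lemma IsNestFun.exists_eq_glueFun {n k : ℕ} {a : ℕ → ℕ} (ha : IsNestFun (n + 1) a)
    (h0 : a 0 = n) (hn : 1 ≤ n) (hk : popFun a 0 = k) :
    ∃ v c, IsNestFun k v ∧ IsNestFun (n - k) c ∧ c 0 = n - k - 1 ∧ glueFun n k (v, c) = a := by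
  obtain ⟨-, hkn, hle⟩ := popFun_admissible a 0
  rw [hk] at hkn hle
  have hkn : k < n := by omega
  have hlast : a (k + 1) = n := by
    have h1 := ha.le (k + 1)
    have h2 := ha.nest 0 (k + 1) (by omega) (by omega)
    by_contra h3
    have : PopAdmissible a 0 (a (k + 1)) := by
      refine ⟨by omega, by omega, fun j hj1 hj2 => ?_⟩
      rcases lt_trichotomy j (k + 1) with h | h | h
      · have := hle j hj1 (by omega)
        omega
      · rw [h]
      · exact ha.nest _ _ h hj2
    have := this.le_popFun
    omega
  refine ⟨fun i => if i < k then a (i + 1) - 1 else i, fun i => a (k + i + 1) - 1 - k,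
    ⟨fun i => ?_, fun i hi => ?_, fun i hi => ?_, fun i j hij hj => ?_⟩,
    ⟨fun i => ?_, fun i hi => ?_, fun i hi => ?_, fun i j hij hj => ?_⟩, ?_, ?_⟩
  · have := ha.le (i + 1)
    split_ifs <;> omega
  · have := ha.le (i + 1)
    have := hle (i + 1) (by omega) (by omega)
    split_ifs
    omega
  · exact if_neg (by omega)
  · have := ha.le (i + 1)
    have := ha.nest (i + 1) (j + 1) (by omega)
    have := hle (i + 1) (by omega)
    split_ifs at * <;> omega
  · have := ha.le (k + i + 1)
    omega
  · have := ha.le (k + i + 1)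
    have := ha.lt (k + i + 1) (by omega)
    omega
  · have := ha.eq (k + i + 1) (by omega)
    omega
  · have := ha.le (k + i + 1)
    have := ha.nest (k + i + 1) (k + j + 1) (by omega)
    omega
  · simp only [add_zero, hlast]
    omega
  · funext i
    cases i with
    | zero => exact h0.symm
    | succ i =>
      have := ha.le (i + 1)
      simp only [glueFun, prependFun, sumFun]
      split_ifs with h
      · omega
      · rw [show k + (i - k) = i by omega]
        omega

lemma injOn_glueFun (t n k m : ℕ) :
    Set.InjOn (glueFun n k) (sortableFuns t k ×ˢ irredSortableFuns t m) := by
  rintro ⟨v, c⟩ ⟨hv, -⟩ ⟨v', c'⟩ ⟨hv', -⟩ h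
  have key : ∀ i, sumFun k v c i = sumFun k v' c' i := fun i =>
    Nat.succ_injective (congrFun h (i + 1))
  refine Prod.ext (funext fun i => ?_) (funext fun i => ?_)
  · by_cases hi : i < k
    · simpa only [sumFun_of_lt _ _ hi] using key i
    · exact (hv.1.eq i (by omega)).trans (hv'.1.eq i (by omega)).symm
  · simpa [sumFun_add] using key (k + i)

lemma fiber_eq_image_glueFun {t n k : ℕ} (ht : 1 ≤ t) (hk : k < n) :
    {a ∈ irredSortableFuns t (n + 1) | popFun a 0 = k} =
      if k < t then glueFun n k '' (sortableFuns t k ×ˢ irredSortableFuns t (n - k)) else ∅ := by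
  have key : ∀ v c, IsNestFun k v → IsNestFun (n - k) c → c 0 = n - k - 1 →
      (popFun^[t] (glueFun n k (v, c)) = id ↔
        k < t ∧ popFun^[t] v = id ∧ popFun^[t] c = id) := by
    intro v c hv hc hc0
    rw [← hv.popFun_iterate_sumFun_eq_id, glueFun, popFun_iterate_prependFun_eq_id ht]
    rw [show popFun (prependFun n (sumFun k v c)) 0 = k from popFun_glueFun_zero hk hv hc0]
  ext a
  constructor
  · rintro ⟨⟨⟨ha, ha0⟩, hs⟩, hak⟩
    obtain ⟨v, c, hv, hc, hc0, rfl⟩ := ha.exists_eq_glueFun ha0 (by omega) hak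
    obtain ⟨h1, h2, h3⟩ := (key v c hv hc hc0).1 hs
    rw [if_pos h1]
    exact ⟨(v, c), ⟨⟨hv, h2⟩, ⟨hc, hc0⟩, h3⟩, rfl⟩
  · split_ifs with hkt
    · rintro ⟨⟨v, c⟩, ⟨⟨hv, h2⟩, ⟨hc, hc0⟩, h3⟩, rfl⟩
      refine ⟨⟨⟨?_, rfl⟩, (key v c hv hc hc0).2 ⟨hkt, h2, h3⟩⟩, popFun_glueFun_zero hk hv hc0⟩
      have := (hv.isNestFun_sumFun hc).isNestFun_prependFun
      rwa [show k + (n - k) = n by omega] at this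
    · exact False.elim

lemma ncard_irredSortableFuns_succ {t n : ℕ} (ht : 1 ≤ t) (hn : 1 ≤ n) :
    (irredSortableFuns t (n + 1)).ncard = ∑ k ∈ Finset.range n,
      (if k < t then (sortableFuns t k).ncard else 0) * (irredSortableFuns t (n - k)).ncard := by
  have hfin := finite_irredSortableFuns t (n + 1)
  rw [Set.ncard_eq_toFinset_card _ hfin,
    Finset.card_eq_sum_card_fiberwise (f := fun a => popFun a 0) (t := Finset.range n)]
  · refine Finset.sum_congr rfl fun k hk => ?_
    rw [← Set.ncard_coe_finset, Finset.coe_filter]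
    simp only [Set.Finite.mem_toFinset]
    rw [fiber_eq_image_glueFun ht (Finset.mem_range.1 hk)]
    split_ifs
    · rw [(injOn_glueFun t n k _).ncard_image, Set.ncard_prod]
    · simp
  · intro a ha
    obtain ⟨⟨-, h0⟩, -⟩ := hfin.mem_toFinset.1 ha
    have := popFun_lt_or_eq a 0
    simp only [Finset.coe_range, Set.mem_Iio]
    omega

lemma isNestFun_id (n : ℕ) : IsNestFun n id :=
  ⟨fun _ => le_rfl, fun _ h => h, fun _ _ => rfl, fun _ _ _ h => h⟩

lemma ncard_sortableFuns_zero (t : ℕ) : (sortableFuns t 0).ncard = 1 := by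
  rw [Set.ncard_eq_one]
  refine ⟨id, Set.eq_singleton_iff_unique_mem.2 ⟨⟨isNestFun_id 0, popFun_iterate_id t⟩, ?_⟩⟩
  exact fun a ha => funext fun i => ha.1.eq i (Nat.zero_le i)

lemma ncard_irredSortableFuns_one (t : ℕ) : (irredSortableFuns t 1).ncard = 1 := by
  rw [Set.ncard_eq_one]
  refine ⟨id, Set.eq_singleton_iff_unique_mem.2
    ⟨⟨⟨isNestFun_id 1, rfl⟩, popFun_iterate_id t⟩, ?_⟩⟩
  rintro a ⟨⟨ha, h0⟩, -⟩
  funext i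
  cases i with
  | zero => exact h0
  | succ i => exact ha.eq _ (by omega)

/-- The bracket vector of size `n` whose entries at even positions are given by `a`. -/
def vecOfFun (n : ℕ) (a : ℕ → ℕ) : List ℕ :=
  (List.range (2 * n)).map fun i => if i % 2 = 0 then a (i / 2) else i / 2

lemma getD_vecOfFun (n : ℕ) (a : ℕ → ℕ) (i : ℕ) : (vecOfFun n a).getD i 0 =
    if i < 2 * n then (if i % 2 = 0 then a (i / 2) else i / 2) else 0 := by
  by_cases h : i < 2 * n <;> simp [vecOfFun, List.getD_eq_getElem?_getD, h]

lemma getD_vecOfFun_even {n k : ℕ} (a : ℕ → ℕ) (hk : k < n) :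
    (vecOfFun n a).getD (2 * k) 0 = a k := by
  rw [getD_vecOfFun, if_pos (by omega), if_pos (by omega)]
  congr 1
  omega

lemma getD_vecOfFun_odd {n k : ℕ} (a : ℕ → ℕ) (hk : k < n) :
    (vecOfFun n a).getD (2 * k + 1) 0 = k := by
  rw [getD_vecOfFun, if_pos (by omega), if_neg (by omega)]
  omega

lemma vecOfFun_id (n : ℕ) : vecOfFun n id = minVec n := by
  simp [vecOfFun, minVec]

lemma injOn_vecOfFun (n : ℕ) : Set.InjOn (vecOfFun n) {a | IsNestFun n a} := by
  intro a ha a' ha' h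
  funext k
  by_cases hk : k < n
  · rw [← getD_vecOfFun_even a hk, h, getD_vecOfFun_even a' hk]
  · exact (ha.eq k (by omega)).trans (ha'.eq k (by omega)).symm

lemma IsNestFun.isBracketVec {n : ℕ} {a : ℕ → ℕ} (ha : IsNestFun n a) :
    IsBracketVec n (vecOfFun n a) := by
  refine ⟨by simp [vecOfFun], fun k hk => getD_vecOfFun_odd a hk, fun i hi => ?_,
    fun i hi j hj1 hj2 => ?_⟩
  · have := ha.le (i / 2)
    have := ha.lt (i / 2) (by omega)
    rw [getD_vecOfFun, if_pos hi]
    split_ifs <;> omega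
  · rw [getD_vecOfFun, if_pos hi] at *
    rw [getD_vecOfFun]
    have := ha.lt (i / 2) (by omega)
    have := ha.nest (i / 2) (j / 2)
    split_ifs at * <;> omega

lemma IsBracketVec.exists_vecOfFun_eq {n : ℕ} {b : List ℕ} (hb : IsBracketVec n b) :
    ∃ a, IsNestFun n a ∧ vecOfFun n a = b := by
  obtain ⟨hlen, hodd, hbd, hnest⟩ := hb
  refine ⟨fun k => if k < n then b.getD (2 * k) 0 else k,
    ⟨fun k => ?_, fun k hk => ?_, fun k hk => if_neg (by omega), fun k j hkj hj => ?_⟩, ?_⟩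
  · have := hbd (2 * k)
    split_ifs <;> omega
  · have := hbd (2 * k) (by omega)
    rw [if_pos hk]
    omega
  · have := hbd (2 * k)
    have := hnest (2 * k)
    split_ifs at * with h1 h2 h3
    · exact hnest (2 * k) (by omega) (2 * j) (by omega) (by omega)
    · omega
    · omega
    · omega
  · refine List.ext_getElem (by simp [vecOfFun, hlen]) fun i h1 h2 => ?_
    rw [← List.getD_eq_getElem _ 0 h1, ← List.getD_eq_getElem _ 0 h2]
    rw [hlen] at h2
    rcases Nat.even_or_odd' i with ⟨k, rfl | rfl⟩
    · rw [getD_vecOfFun_even _ (by omega), if_pos (by omega)]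
    · rw [getD_vecOfFun_odd _ (by omega), hodd k (by omega)]

lemma IsNestFun.popVec_vecOfFun {n : ℕ} {a : ℕ → ℕ} (ha : IsNestFun n a) :
    popVec n (vecOfFun n a) = vecOfFun n (popFun a) := by
  refine List.map_congr_left fun i hi => ?_
  rw [List.mem_range] at hi
  rcases Nat.even_or_odd' i with ⟨k, rfl | rfl⟩
  · have hk : k < n := by omega
    have h1 := ha.le k
    have h2 := ha.lt k hk
    rw [if_pos (by omega), show 2 * k / 2 = k by omega, eta, getD_vecOfFun_even a hk,
      getD_vecOfFun_odd a hk]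
    split_ifs with h
    · have h3 : a k = k := by omega
      rw [popFun_eq_self h3, h3]
    · have h3 := popFun_admissible a k
      apply le_antisymm
      · refine Finset.sup_le fun x hx => ?_
        simp only [Finset.mem_filter, Finset.mem_range, Finset.mem_Icc] at hx
        obtain ⟨hx1, hx2, hx3⟩ := hx
        refine PopAdmissible.le_popFun ⟨by simp only [id]; omega, Or.inl hx1, fun j hj1 hj2 => ?_⟩
        simp only [id] at *
        rw [← getD_vecOfFun_even a (show j < n by omega)]
        exact hx3 (2 * j) (by omega)
      · refine Finset.le_sup (f := id) (b := popFun a k) ?_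
        simp only [Finset.mem_filter, Finset.mem_range, Finset.mem_Icc]
        obtain ⟨hx1, hx2, hx3⟩ := h3
        refine ⟨by omega, by omega, fun j hj => ?_⟩
        rw [getD_vecOfFun]
        have := hx3 (j / 2)
        split_ifs <;> omega
  · have hk : k < n := by omega
    rw [if_neg (by omega), eta, getD_vecOfFun_odd a hk, if_pos]
    · omega
    · by_cases h : k + 1 < n
      · right
        rw [show 2 * k + 1 + 1 = 2 * (k + 1) by omega, getD_vecOfFun_even a h]
        have := ha.le (k + 1)
        omega
      · left
        omega

lemma IsNestFun.popSortable_vecOfFun {n : ℕ} {a : ℕ → ℕ} (ha : IsNestFun n a) (t : ℕ) :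
    PopSortable n t (vecOfFun n a) ↔ popFun^[t] a = id := by
  have key : (popVec n)^[t] (vecOfFun n a) = vecOfFun n (popFun^[t] a) := by
    induction t generalizing a with
    | zero => rfl
    | succ t ih =>
      rw [Function.iterate_succ_apply, Function.iterate_succ_apply, ha.popVec_vecOfFun,
        ih ha.isNestFun_popFun]
  rw [PopSortable, key, ← vecOfFun_id]
  exact (injOn_vecOfFun n).eq_iff (ha.iterate t) (isNestFun_id n)

lemma ncard_isBracketVec_popSortable (t n : ℕ) :
    {b : List ℕ | IsBracketVec n b ∧ PopSortable n t b}.ncard = (sortableFuns t n).ncard := by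
  rw [← ((injOn_vecOfFun n).mono fun _ (h : _ ∈ sortableFuns t n) => h.1).ncard_image]
  congr 1
  ext b
  constructor
  · rintro ⟨hb, hs⟩
    obtain ⟨a, ha, rfl⟩ := hb.exists_vecOfFun_eq
    exact ⟨a, ⟨ha, (ha.popSortable_vecOfFun t).1 hs⟩, rfl⟩
  · rintro ⟨a, ⟨ha, hs⟩, rfl⟩
    exact ⟨ha.isBracketVec, (ha.popSortable_vecOfFun t).2 hs⟩

lemma ncard_isIrredVec_popSortable (t : ℕ) {n : ℕ} (hn : 1 ≤ n) :
    {b : List ℕ | IsIrredVec n b ∧ PopSortable n t b}.ncard = (irredSortableFuns t n).ncard := by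
  rw [← ((injOn_vecOfFun n).mono
    fun _ (h : _ ∈ irredSortableFuns t n) => h.1.1).ncard_image]
  have key : ∀ a, (vecOfFun n a).getD 0 0 = (vecOfFun n a).getD (2 * n - 1) 0 ↔
      a 0 = n - 1 := by
    intro a
    have h1 := getD_vecOfFun_even a (show 0 < n by omega)
    have h2 := getD_vecOfFun_odd a (show n - 1 < n by omega)
    rw [show 2 * (n - 1) + 1 = 2 * n - 1 by omega] at h2
    rw [mul_zero] at h1
    rw [h1, h2]
  congr 1
  ext b
  constructor
  · rintro ⟨⟨hb, hi⟩, hs⟩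
    obtain ⟨a, ha, rfl⟩ := hb.exists_vecOfFun_eq
    exact ⟨a, ⟨⟨ha, (key a).1 hi⟩, (ha.popSortable_vecOfFun t).1 hs⟩, rfl⟩
  · rintro ⟨a, ⟨⟨ha, hi⟩, hs⟩, rfl⟩
    exact ⟨⟨ha.isBracketVec, (key a).2 hi⟩, (ha.popSortable_vecOfFun t).2 hs⟩

open PowerSeries in
/-- **Theorem (Statement 7).** Fix `t ≥ 1`.  With `g_t(n)` the number of
`t`-Pop-sortable irreducible bracket vectors of size `n`, `h_t(n)` the number of
`t`-Pop-sortable bracket vectors of size `n`, `G_t(z) = ∑_{n≥1} g_t(n) zⁿ` and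
`H̃_t(z) = ∑_{n=1}^{t-1} h_t(n) zⁿ`, we have `G_t(z) = z·((1 + H̃_t(z))·G_t(z) + 1)`. -/
theorem irreducible_sortable_gf_equation (t : ℕ) (ht : 1 ≤ t) :
    (PowerSeries.mk fun n =>
        if n = 0 then 0
        else (Set.ncard {b : List ℕ | IsIrredVec n b ∧ PopSortable n t b} : ℤ)) =
      (X : PowerSeries ℤ) *
        ((1 + PowerSeries.mk fun n =>
            if 1 ≤ n ∧ n ≤ t - 1 then
              (Set.ncard {b : List ℕ | IsBracketVec n b ∧ PopSortable n t b} : ℤ)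
            else 0) *
          (PowerSeries.mk fun n =>
            if n = 0 then 0
            else (Set.ncard {b : List ℕ | IsIrredVec n b ∧ PopSortable n t b} : ℤ)) + 1) := by
  have hG : ∀ n, (if n = 0 then 0
      else (Set.ncard {b : List ℕ | IsIrredVec n b ∧ PopSortable n t b} : ℤ)) =
      if n = 0 then 0 else ((irredSortableFuns t n).ncard : ℤ) := fun n => by
    split_ifs with h
    · rfl
    · rw [ncard_isIrredVec_popSortable t (by omega)]
  simp only [hG, ncard_isBracketVec_popSortable]
  ext n
  rcases n with _ | n
  · simp
  rw [coeff_succ_X_mul, map_add, coeff_mk, if_neg n.succ_ne_zero]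
  rcases Nat.eq_zero_or_pos n with rfl | hn
  · simp [ncard_irredSortableFuns_one]
  rw [ncard_irredSortableFuns_succ ht hn, coeff_mul,
    Finset.Nat.sum_antidiagonal_eq_sum_range_succ_mk, Finset.sum_range_succ,
    coeff_one, if_neg hn.ne', add_zero]
  simp only [coeff_mk, Nat.sub_self, if_true, mul_zero, add_zero]
  push_cast
  refine Finset.sum_congr rfl fun k hk => ?_
  rw [Finset.mem_range] at hk
  rw [if_neg (show n - k ≠ 0 by omega), map_add, coeff_one, coeff_mk]
  congr 1
  rcases Nat.eq_zero_or_pos k with rfl | hk0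
  · simp [ncard_sortableFuns_zero, show 0 < t by omega]
  · rw [if_neg hk0.ne', zero_add]
    exact if_congr (by omega) rfl rfl
end
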